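/- arXiv:2205.13205 — 9 statements merged into one kernel-verified Lean document; each statement's English description precedes it below -/
import Mathlib

section
/- Let N ≥ 2, d ≥ 1, and let G : ℝ^d → ℝ^d → Multiset(ℝ^d) → ℝ satisfy G(a, b, S) = −G(b, a, S) for all a, b ∈ ℝ^d and every multiset S. Define ψ_pair(x) = ∏_{i<j} G(x_i, x_j, R_{ij}(x)) over all pairs of indices i < j in Fin N, where x : Fin N → ℝ^d and R_{ij}(x) is the multiset of the values x_k for k ∉ {i, j}. Then for any two distinct indices m, n ∈ Fin N, ψ_pair(x ∘ (swap m n)) = −ψ_pair(x) for every x, where swap m n is the transposition of m and n. -/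
open Finset

/-- The multiset of coordinates `x k` for indices `k ∉ {i, j}`. -/
def restPair {N d : ℕ} (x : Fin N → EuclideanSpace ℝ (Fin d)) (i j : Fin N) :
    Multiset (EuclideanSpace ℝ (Fin d)) :=
  Multiset.map x (Finset.univ.filter (fun k => k ≠ i ∧ k ≠ j)).val

/-- The pairwise wavefunction Ansatz built from `G`. -/
noncomputable def psiPair {N d : ℕ}
    (G : EuclideanSpace ℝ (Fin d) → EuclideanSpace ℝ (Fin d) →
      Multiset (EuclideanSpace ℝ (Fin d)) → ℝ)
    (x : Fin N → EuclideanSpace ℝ (Fin d)) : ℝ :=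
  ∏ p ∈ Finset.univ.filter (fun p : Fin N × Fin N => p.1 < p.2),
    G (x p.1) (x p.2) (restPair x p.1 p.2)

/-- The rest multiset transforms equivariantly under relabelling. -/
theorem restPair_comp {N d : ℕ} (x : Fin N → EuclideanSpace ℝ (Fin d))
    (σ : Equiv.Perm (Fin N)) (i j : Fin N) :
    restPair (x ∘ σ) i j = restPair x (σ i) (σ j) := by
  unfold restPair
  have h : (Finset.univ.filter (fun k => k ≠ σ i ∧ k ≠ σ j)) =
      (Finset.univ.filter (fun k => k ≠ i ∧ k ≠ j)).map σ.toEmbedding := by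
    ext k
    simp [Finset.mem_map_equiv, Equiv.symm_apply_eq]
  rw [h, Finset.map_val, Multiset.map_map]
  rfl

theorem restPair_comm {N d : ℕ} (x : Fin N → EuclideanSpace ℝ (Fin d)) (i j : Fin N) :
    restPair x i j = restPair x j i := by
  unfold restPair
  simp only [and_comm]

theorem psiPair_eq {N d : ℕ}
    (G : EuclideanSpace ℝ (Fin d) → EuclideanSpace ℝ (Fin d) →
      Multiset (EuclideanSpace ℝ (Fin d)) → ℝ)
    (x : Fin N → EuclideanSpace ℝ (Fin d)) :
    psiPair G x = ∏ i, ∏ j ∈ Finset.Ioi i, G (x i) (x j) (restPair x i j) := by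
  unfold psiPair
  rw [Finset.prod_filter, Fintype.prod_prod_type]
  refine Finset.prod_congr rfl fun i _ => ?_
  rw [← Finset.prod_filter]
  refine Finset.prod_congr ?_ fun _ _ => rfl
  ext j
  simp

theorem psiPair_antisymmetric_swap (N d : ℕ) (hN : 2 ≤ N) (hd : 1 ≤ d)
    (G : EuclideanSpace ℝ (Fin d) → EuclideanSpace ℝ (Fin d) →
      Multiset (EuclideanSpace ℝ (Fin d)) → ℝ)
    (hG : ∀ a b S, G a b S = - G b a S)
    (m n : Fin N) (hmn : m ≠ n) (x : Fin N → EuclideanSpace ℝ (Fin d)) :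
    psiPair G (x ∘ Equiv.swap m n) = - psiPair G x := by
  rw [psiPair_eq, psiPair_eq]
  have key := (Equiv.swap m n).prod_Ioi_comp_eq_sign_mul_prod
    (f := fun i j => G (x i) (x j) (restPair x i j))
    (fun i j => by rw [hG, restPair_comm])
  rw [Equiv.Perm.sign_swap hmn] at key
  simp only [restPair_comp, Function.comp_apply]
  simpa using key
end

section
/- Let N ≥ 2, d ≥ 1, and let Φ_A, Φ_B : ((Fin N) → ℝ^d) → (Fin N → ℝ) both be permutation-equivariant, i.e., Φ(x ∘ σ) = Φ(x) ∘ σ for every permutation σ of Fin N. Define ψ''_pair(x) = ∏_{i<j} (Φ_A(x)(i)·Φ_B(x)(j) − Φ_A(x)(j)·Φ_B(x)(i)) over all pairs i < j in Fin N. Then ψ''_pair is antisymmetric: for every permutation σ of Fin N and every x, ψ''_pair(x ∘ σ) = sign(σ) · ψ''_pair(x). -/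
open Finset

/-- `Φ` is permutation-equivariant: `Φ (x ∘ σ) = Φ x ∘ σ`. -/
def PermEquivariant {N d : ℕ}
    (Φ : (Fin N → EuclideanSpace ℝ (Fin d)) → (Fin N → ℝ)) : Prop :=
  ∀ (σ : Equiv.Perm (Fin N)) (x : Fin N → EuclideanSpace ℝ (Fin d)),
    Φ (x ∘ σ) = Φ x ∘ σ

/-- The extended pairwise Ansatz
`ψ''_pair(x) = ∏_{i<j} (Φ_A(x)(i)·Φ_B(x)(j) − Φ_A(x)(j)·Φ_B(x)(i))`. -/
noncomputable def psiPair'' {N d : ℕ}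
    (ΦA ΦB : (Fin N → EuclideanSpace ℝ (Fin d)) → (Fin N → ℝ))
    (x : Fin N → EuclideanSpace ℝ (Fin d)) : ℝ :=
  ∏ p ∈ Finset.univ.filter (fun p : Fin N × Fin N => p.1 < p.2),
    (ΦA x p.1 * ΦB x p.2 - ΦA x p.2 * ΦB x p.1)

theorem psiPair''_antisymmetric (N d : ℕ) (hN : 2 ≤ N) (hd : 1 ≤ d)
    (ΦA ΦB : (Fin N → EuclideanSpace ℝ (Fin d)) → (Fin N → ℝ))
    (hΦA : PermEquivariant ΦA) (hΦB : PermEquivariant ΦB)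
    (σ : Equiv.Perm (Fin N)) (x : Fin N → EuclideanSpace ℝ (Fin d)) :
    psiPair'' ΦA ΦB (x ∘ σ) = ((Equiv.Perm.sign σ : ℤ) : ℝ) * psiPair'' ΦA ΦB x := by
  have key : ∀ f : Fin N → Fin N → ℝ,
      ∏ p ∈ Finset.univ.filter (fun p : Fin N × Fin N => p.1 < p.2), f p.1 p.2
        = ∏ i, ∏ j ∈ Finset.Ioi i, f i j := by
    intro f
    rw [Finset.prod_filter, Fintype.prod_prod_type]
    refine Finset.prod_congr rfl fun i _ => ?_
    rw [← Finset.prod_filter]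
    refine Finset.prod_congr ?_ fun _ _ => rfl
    ext j
    simp
  unfold psiPair''
  rw [hΦA σ x, hΦB σ x]
  simp only [Function.comp_apply]
  rw [key (fun i j => ΦA x (σ i) * ΦB x (σ j) - ΦA x (σ j) * ΦB x (σ i)),
    key (fun i j => ΦA x i * ΦB x j - ΦA x j * ΦB x i)]
  exact σ.prod_Ioi_comp_eq_sign_mul_prod
    (f := fun i j => ΦA x i * ΦB x j - ΦA x j * ΦB x i) (fun i j => by ring)
end

section
/- Let d ≥ 1 and let Ψ : ℝ^d × ℝ^d × ℝ^d → ℝ. Suppose there exist four points x₁, x₂, x₃, x₄ ∈ ℝ^d with Ψ(x₁,x₂,x₃) · Ψ(x₁,x₂,x₄) · Ψ(x₁,x₃,x₄) · Ψ(x₂,x₃,x₄) < 0. Then for every function φ : ℝ^d → ℝ^d → ℝ, setting a(u,v) = φ(v,u) − φ(u,v) and A(u,v,w) = a(u,v)·a(u,w)·a(v,w), at least one of the four triples t ∈ {(x₁,x₂,x₃), (x₁,x₂,x₄), (x₁,x₃,x₄), (x₂,x₃,x₄)} satisfies A(t) · Ψ(t) ≤ 0, and at least one of the four triples t satisfies A(t)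 · Ψ(t) ≥ 0. In particular, the sign of A cannot agree with the sign of Ψ on all four triples, nor with the sign of −Ψ on all four triples. -/
/-- The antisymmetrized pairwise factor `a(u,v) = φ(v,u) − φ(u,v)`. -/
def pairFactor {d : ℕ}
    (φ : EuclideanSpace ℝ (Fin d) → EuclideanSpace ℝ (Fin d) → ℝ)
    (u v : EuclideanSpace ℝ (Fin d)) : ℝ :=
  φ v u - φ u v

/-- The three-electron pairwise product `A(u,v,w) = a(u,v)·a(u,w)·a(v,w)`. -/
def tripleProd {d : ℕ}
    (φ : EuclideanSpace ℝ (Fin d) → EuclideanSpace ℝ (Fin d) → ℝ)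
    (u v w : EuclideanSpace ℝ (Fin d)) : ℝ :=
  pairFactor φ u v * pairFactor φ u w * pairFactor φ v w

theorem sign_mismatch_on_some_triple (d : ℕ) (hd : 1 ≤ d)
    (Ψ : EuclideanSpace ℝ (Fin d) × EuclideanSpace ℝ (Fin d) × EuclideanSpace ℝ (Fin d) → ℝ)
    (x₁ x₂ x₃ x₄ : EuclideanSpace ℝ (Fin d))
    (hΨ : Ψ (x₁, x₂, x₃) * Ψ (x₁, x₂, x₄) * Ψ (x₁, x₃, x₄) * Ψ (x₂, x₃, x₄) < 0)
    (φ : EuclideanSpace ℝ (Fin d) → EuclideanSpace ℝ (Fin d) → ℝ) :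
    (tripleProd φ x₁ x₂ x₃ * Ψ (x₁, x₂, x₃) ≤ 0 ∨
     tripleProd φ x₁ x₂ x₄ * Ψ (x₁, x₂, x₄) ≤ 0 ∨
     tripleProd φ x₁ x₃ x₄ * Ψ (x₁, x₃, x₄) ≤ 0 ∨
     tripleProd φ x₂ x₃ x₄ * Ψ (x₂, x₃, x₄) ≤ 0) ∧
    (0 ≤ tripleProd φ x₁ x₂ x₃ * Ψ (x₁, x₂, x₃) ∨
     0 ≤ tripleProd φ x₁ x₂ x₄ * Ψ (x₁, x₂, x₄) ∨
     0 ≤ tripleProd φ x₁ x₃ x₄ * Ψ (x₁, x₃, x₄) ∨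
     0 ≤ tripleProd φ x₂ x₃ x₄ * Ψ (x₂, x₃, x₄)) := by
  have key : (tripleProd φ x₁ x₂ x₃ * Ψ (x₁, x₂, x₃)) * (tripleProd φ x₁ x₂ x₄ * Ψ (x₁, x₂, x₄)) *
      ((tripleProd φ x₁ x₃ x₄ * Ψ (x₁, x₃, x₄)) * (tripleProd φ x₂ x₃ x₄ * Ψ (x₂, x₃, x₄))) ≤ 0 := by
    have h : (tripleProd φ x₁ x₂ x₃ * Ψ (x₁, x₂, x₃)) * (tripleProd φ x₁ x₂ x₄ * Ψ (x₁, x₂, x₄)) *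
        ((tripleProd φ x₁ x₃ x₄ * Ψ (x₁, x₃, x₄)) * (tripleProd φ x₂ x₃ x₄ * Ψ (x₂, x₃, x₄))) =
        (pairFactor φ x₁ x₂ * pairFactor φ x₁ x₃ * pairFactor φ x₁ x₄ * pairFactor φ x₂ x₃ *
          pairFactor φ x₂ x₄ * pairFactor φ x₃ x₄) ^ 2 *
        (Ψ (x₁, x₂, x₃) * Ψ (x₁, x₂, x₄) * Ψ (x₁, x₃, x₄) * Ψ (x₂, x₃, x₄)) := by
      unfold tripleProd
      ring
    rw [h]
    exact mul_nonpos_of_nonneg_of_nonpos (sq_nonneg _) hΨ.le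
  constructor
  · by_contra! hc
    obtain ⟨h1, h2, h3, h4⟩ := hc
    exact absurd key (not_le.mpr (mul_pos (mul_pos h1 h2) (mul_pos h3 h4)))
  · by_contra! hc
    obtain ⟨h1, h2, h3, h4⟩ := hc
    exact absurd key (not_le.mpr
      (mul_pos (mul_pos_of_neg_of_neg h1 h2) (mul_pos_of_neg_of_neg h3 h4)))
end

section
/- Let d ≥ 1 and let Ψ : ℝ^d × ℝ^d × ℝ^d → ℝ be continuous. Suppose there exist points x₁, x₃, x₄ ∈ ℝ^d with Ψ(x₁, x₃, x₄) ≠ 0, and such that for every δ > 0 there exists x₂ ∈ ℝ^d with ‖x₂ − x₁‖ < δ and Ψ(x₁, x₂, x₃) · Ψ(x₁, x₂, x₄) < 0. Then there exist four points y₁, y₂, y₃, y₄ ∈ ℝ^d with Ψ(y₁,y₂,y₃) · Ψ(y₁,y₂,y₄) · Ψ(y₁,y₃,y₄) · Ψ(y₂,y₃,y₄) < 0. -/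
theorem exists_negative_quadruple_product (d : ℕ) (hd : 1 ≤ d)
    (Ψ : EuclideanSpace ℝ (Fin d) × EuclideanSpace ℝ (Fin d) × EuclideanSpace ℝ (Fin d) → ℝ)
    (hΨcont : Continuous Ψ)
    (x₁ x₃ x₄ : EuclideanSpace ℝ (Fin d))
    (hne : Ψ (x₁, x₃, x₄) ≠ 0)
    (hclose : ∀ δ : ℝ, 0 < δ → ∃ x₂ : EuclideanSpace ℝ (Fin d),
      ‖x₂ - x₁‖ < δ ∧ Ψ (x₁, x₂, x₃) * Ψ (x₁, x₂, x₄) < 0) :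
    ∃ y₁ y₂ y₃ y₄ : EuclideanSpace ℝ (Fin d),
      Ψ (y₁, y₂, y₃) * Ψ (y₁, y₂, y₄) * Ψ (y₁, y₃, y₄) * Ψ (y₂, y₃, y₄) < 0 := by
  have hc : Continuous fun x => Ψ (x₁, x₃, x₄) * Ψ (x, x₃, x₄) := by fun_prop
  have hpos : 0 < Ψ (x₁, x₃, x₄) * Ψ (x₁, x₃, x₄) := mul_self_pos.mpr hne
  have hev : ∀ᶠ x in nhds x₁, 0 < Ψ (x₁, x₃, x₄) * Ψ (x, x₃, x₄) :=
    hc.continuousAt.eventually (lt_mem_nhds hpos)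
  obtain ⟨δ, hδ, h⟩ := Metric.eventually_nhds_iff.mp hev
  obtain ⟨x₂, h1, h2⟩ := hclose δ hδ
  have h3 := h (y := x₂) (by rwa [dist_eq_norm])
  refine ⟨x₁, x₂, x₃, x₄, ?_⟩
  rw [mul_assoc (Ψ (x₁, x₂, x₃) * Ψ (x₁, x₂, x₄))]
  exact mul_neg_of_neg_of_pos h2 h3
end

section
/- Let N ≥ 2, d ≥ 1, and let Ψ, A : ((Fin N) → ℝ^d) → ℝ be continuous functions that are both antisymmetric (f(x ∘ σ) = sign(σ) · f(x) for every permutation σ of Fin N). Assume Ψ satisfies the tiling property, that the zero set of A is contained in the zero set of Ψ (i.e., ∀x, A(x) = 0 → Ψ(x) = 0), and that there exists x' with Ψ(x') ≠ 0 and A(x') · Ψ(x') < 0. Then for every x with Ψ(x) ≠ 0, A(x) · Ψ(x) < 0. -/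
/-- `f` is antisymmetric: `f (x ∘ σ) = sign σ · f x` for every permutation `σ`. -/
def Antisymmetric' {N d : ℕ}
    (f : (Fin N → EuclideanSpace ℝ (Fin d)) → ℝ) : Prop :=
  ∀ (σ : Equiv.Perm (Fin N)) (x : Fin N → EuclideanSpace ℝ (Fin d)),
    f (x ∘ σ) = ((Equiv.Perm.sign σ : ℤ) : ℝ) * f x

/-- The tiling property: for every `x` off the node set, the nodal cells of the
permuted copies of `x` cover the whole complement of the node set. -/
def TilingProperty {N d : ℕ}
    (Ψ : (Fin N → EuclideanSpace ℝ (Fin d)) → ℝ) : Prop :=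
  ∀ x, Ψ x ≠ 0 → ∀ y, Ψ y ≠ 0 → ∃ σ : Equiv.Perm (Fin N),
    y ∈ connectedComponentIn {z | Ψ z ≠ 0} (x ∘ σ)

theorem sign_mismatch_everywhere (N d : ℕ) (hN : 2 ≤ N) (hd : 1 ≤ d)
    (Ψ A : (Fin N → EuclideanSpace ℝ (Fin d)) → ℝ)
    (hΨcont : Continuous Ψ) (hAcont : Continuous A)
    (hΨanti : Antisymmetric' Ψ) (hAanti : Antisymmetric' A)
    (hTiling : TilingProperty Ψ)
    (hzero : ∀ x, A x = 0 → Ψ x = 0)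
    (x' : Fin N → EuclideanSpace ℝ (Fin d))
    (hx'ne : Ψ x' ≠ 0) (hx'neg : A x' * Ψ x' < 0) :
    ∀ x, Ψ x ≠ 0 → A x * Ψ x < 0 := by
  intro x hx
  obtain ⟨σ, hσ⟩ := hTiling x' hx'ne x hx
  have hsq : (((Equiv.Perm.sign σ : ℤ) : ℝ)) * ((Equiv.Perm.sign σ : ℤ) : ℝ) = 1 := by
    rcases Int.units_eq_one_or (Equiv.Perm.sign σ) with h | h <;> simp [h]
  have hprod : A (x' ∘ σ) * Ψ (x' ∘ σ) = A x' * Ψ x' := by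
    rw [hAanti, hΨanti]
    linear_combination (A x' * Ψ x') * hsq
  have hneg : A (x' ∘ σ) * Ψ (x' ∘ σ) < 0 := hprod ▸ hx'neg
  have hmem : x' ∘ σ ∈ {z | Ψ z ≠ 0} := fun h => by
    rw [h, mul_zero] at hneg
    exact lt_irrefl _ hneg
  by_contra hcon
  have hivt := isPreconnected_connectedComponentIn.intermediate_value
    (mem_connectedComponentIn hmem) hσ (hAcont.mul hΨcont).continuousOn
  obtain ⟨z, hz, hz0⟩ := hivt ⟨hneg.le, not_lt.mp hcon⟩
  have hzΨ : Ψ z ≠ 0 := connectedComponentIn_subset _ _ hz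
  rcases mul_eq_zero.mp hz0 with h | h
  · exact hzΨ (hzero z h)
  · exact hzΨ h
end

section
/- Let d ≥ 1 and let Ψ : ((Fin 3) → ℝ^d) → ℝ be continuous, antisymmetric (Ψ(x ∘ σ) = sign(σ) · Ψ(x) for every permutation σ of Fin 3), and satisfy the tiling property. Suppose there exist four points x₁, x₂, x₃, x₄ ∈ ℝ^d with Ψ(x₁,x₂,x₃) · Ψ(x₁,x₂,x₄) · Ψ(x₁,x₃,x₄) · Ψ(x₂,x₃,x₄) < 0. Then for every continuous φ_B : ℝ^d → ℝ^d → ℝ, defining A(x) = a(x₀',x₁')·a(x₀',x₂')·a(x₁',x₂') for a configuration x = (x₀',x₁',x₂') with a(u,v) = φ_B(v,u) − φ_B(u,v), there exists a configuration x'' with A(x'') = 0 and Ψ(x'') ≠ 0; that is, the zero set of A is not contained in the node set of Ψ. -/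
/-- The pairwise product `A(x; φ_B) = ∏_{i<j} a(x_i, x_j)` for a three-electron
configuration. -/
def hanProd {d : ℕ}
    (φ : EuclideanSpace ℝ (Fin d) → EuclideanSpace ℝ (Fin d) → ℝ)
    (x : Fin 3 → EuclideanSpace ℝ (Fin d)) : ℝ :=
  pairFactor φ (x 0) (x 1) * pairFactor φ (x 0) (x 2) * pairFactor φ (x 1) (x 2)

theorem hanProd_anti {d : ℕ}
    (φ : EuclideanSpace ℝ (Fin d) → EuclideanSpace ℝ (Fin d) → ℝ) :
    Antisymmetric' (hanProd φ) := by
  intro σ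
  induction σ using Equiv.Perm.swap_induction_on with
  | one => intro x; simp
  | swap_mul f i j hij ih =>
    intro x
    have h1 : x ∘ (Equiv.swap i j * f : Equiv.Perm (Fin 3)) = (x ∘ Equiv.swap i j) ∘ f := rfl
    have h2 : hanProd φ (x ∘ Equiv.swap i j) = - hanProd φ x := by
      fin_cases i <;> fin_cases j <;>
        first
        | exact absurd rfl hij
        | (simp [hanProd, pairFactor, Equiv.swap_apply_def]; ring)
    rw [h1, ih, h2, Equiv.Perm.sign_mul, Equiv.Perm.sign_swap hij]
    push_cast
    ring

theorem zero_set_not_subset_node_set (d : ℕ) (hd : 1 ≤ d)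
    (Ψ : (Fin 3 → EuclideanSpace ℝ (Fin d)) → ℝ)
    (hΨcont : Continuous Ψ) (hΨanti : Antisymmetric' Ψ)
    (hTiling : TilingProperty Ψ)
    (x₁ x₂ x₃ x₄ : EuclideanSpace ℝ (Fin d))
    (hΨneg : Ψ ![x₁, x₂, x₃] * Ψ ![x₁, x₂, x₄] * Ψ ![x₁, x₃, x₄] * Ψ ![x₂, x₃, x₄] < 0)
    (φB : EuclideanSpace ℝ (Fin d) → EuclideanSpace ℝ (Fin d) → ℝ)
    (hφBcont : Continuous fun p : EuclideanSpace ℝ (Fin d) × EuclideanSpace ℝ (Fin d) =>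
      φB p.1 p.2) :
    ∃ x'' : Fin 3 → EuclideanSpace ℝ (Fin d), hanProd φB x'' = 0 ∧ Ψ x'' ≠ 0 := by
  by_contra hcon
  push Not at hcon
  have hA : ∀ x, Ψ x ≠ 0 → hanProd φB x ≠ 0 := fun x hx h0 => hx (hcon x h0)
  have hac : Continuous fun x : Fin 3 → EuclideanSpace ℝ (Fin d) => hanProd φB x := by
    have hp : ∀ i j : Fin 3, Continuous
        fun x : Fin 3 → EuclideanSpace ℝ (Fin d) => φB (x i) (x j) := fun i j =>
      hφBcont.comp (f := fun x : Fin 3 → EuclideanSpace ℝ (Fin d) => (x i, x j)) ((continuous_apply i).prodMk (continuous_apply j))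
    unfold hanProd pairFactor
    exact (((hp 1 0).sub (hp 0 1)).mul ((hp 2 0).sub (hp 0 2))).mul ((hp 2 1).sub (hp 1 2))
  set g : (Fin 3 → EuclideanSpace ℝ (Fin d)) → ℝ := fun x => hanProd φB x * Ψ x with hg
  have hgc : Continuous g := hac.mul hΨcont
  have hgs : ∀ (σ : Equiv.Perm (Fin 3)) x, g (x ∘ σ) = g x := by
    intro σ x
    simp only [hg]
    rw [hanProd_anti φB σ x, hΨanti σ x]
    rcases Int.units_eq_one_or (Equiv.Perm.sign σ) with h | h <;> simp [h]
  have hg0 : ∀ x, Ψ x ≠ 0 → g x ≠ 0 := fun x hx => mul_ne_zero (hA x hx) hx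
  have key : ∀ x, Ψ x ≠ 0 → ∀ y, Ψ y ≠ 0 → 0 < g x * g y := by
    intro x hx y hy
    obtain ⟨σ, hσ⟩ := hTiling x hx y hy
    have hmem := connectedComponentIn_nonempty_iff.1 ⟨y, hσ⟩
    have hself := mem_connectedComponentIn hmem
    have hpre : IsPreconnected (connectedComponentIn {z | Ψ z ≠ 0} (x ∘ σ)) :=
      isPreconnected_connectedComponentIn
    have hz : (0 : ℝ) ∉ g '' connectedComponentIn {z | Ψ z ≠ 0} (x ∘ σ) := by
      rintro ⟨z, hz, h0⟩
      exact hg0 z (connectedComponentIn_subset _ _ hz) h0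
    rw [← hgs σ x]
    by_contra hneg
    push Not at hneg
    rcases mul_nonpos_iff.1 hneg with h | h
    · exact hz (hpre.intermediate_value hσ hself hgc.continuousOn ⟨h.2, h.1⟩)
    · exact hz (hpre.intermediate_value hself hσ hgc.continuousOn ⟨h.1, h.2⟩)
  have n4 : Ψ ![x₂, x₃, x₄] ≠ 0 := fun h => by simp [h] at hΨneg
  have n3 : Ψ ![x₁, x₃, x₄] ≠ 0 := fun h => by simp [h] at hΨneg
  have n2 : Ψ ![x₁, x₂, x₄] ≠ 0 := fun h => by simp [h] at hΨneg
  have n1 : Ψ ![x₁, x₂, x₃] ≠ 0 := fun h => by simp [h] at hΨneg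
  have hpos := mul_pos (key _ n1 _ n2) (key _ n3 _ n4)
  have hsq : 0 ≤ hanProd φB ![x₁, x₂, x₃] * hanProd φB ![x₁, x₂, x₄] *
      hanProd φB ![x₁, x₃, x₄] * hanProd φB ![x₂, x₃, x₄] := by
    have : hanProd φB ![x₁, x₂, x₃] * hanProd φB ![x₁, x₂, x₄] *
      hanProd φB ![x₁, x₃, x₄] * hanProd φB ![x₂, x₃, x₄] =
      (pairFactor φB x₁ x₂ * pairFactor φB x₁ x₃ * pairFactor φB x₁ x₄ *
        pairFactor φB x₂ x₃ * pairFactor φB x₂ x₄ * pairFactor φB x₃ x₄) ^ 2 := by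
      simp [hanProd]
      ring
    rw [this]
    positivity
  have hle := mul_nonpos_of_nonneg_of_nonpos hsq hΨneg.le
  simp only [hg] at hpos
  linarith
end

section
/- Let d ≥ 1 and let Ψ : ((Fin 3) → ℝ^d) → ℝ be continuous, antisymmetric (Ψ(x ∘ σ) = sign(σ) · Ψ(x) for every permutation σ of Fin 3), and satisfy the tiling property. Suppose there exist four points x₁, x₂, x₃, x₄ ∈ ℝ^d with Ψ(x₁,x₂,x₃) · Ψ(x₁,x₂,x₄) · Ψ(x₁,x₃,x₄) · Ψ(x₂,x₃,x₄) < 0. Then there do not exist a continuous function φ_B : ℝ^d → ℝ^d → ℝ and a function φ_C : ((Fin 3) → ℝ^d) → ℝ such that for every configuration x = (x₀',x₁',x₂'), φ_C(x) · (φ_B(x₁',x₀') − φ_B(x₀',x₁')) · (φ_B(x₂',x₀') − φ_B(x₀',x₂')) · (φ_B(x₂',x₁') − φ_B(x₁',x₂')) = Ψ(x). In particular, if ψ_Han = Ψ everywhere then at least one of φ_B, φ_C is discontinuous. -/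
theorem han_aux_perm {E : Type*} (a : E → E → ℝ) (ha : ∀ x y, a x y = - a y x)
    (σ : Equiv.Perm (Fin 3)) : ∀ x : Fin 3 → E,
    a (x (σ 0)) (x (σ 1)) * a (x (σ 0)) (x (σ 2)) * a (x (σ 1)) (x (σ 2))
      = ((Equiv.Perm.sign σ : ℤ) : ℝ) * (a (x 0) (x 1) * a (x 0) (x 2) * a (x 1) (x 2)) := by
  induction σ using Equiv.Perm.swap_induction_on with
  | one => intro x; simp
  | swap_mul f i j hij ih =>
    intro x
    have h := ih (x ∘ Equiv.swap i j)
    simp only [Function.comp] at h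
    simp only [Equiv.Perm.mul_apply, Equiv.Perm.sign_mul, Equiv.Perm.sign_swap hij]
    rw [h]
    have key : a (x (Equiv.swap i j 0)) (x (Equiv.swap i j 1)) *
        a (x (Equiv.swap i j 0)) (x (Equiv.swap i j 2)) *
        a (x (Equiv.swap i j 1)) (x (Equiv.swap i j 2))
        = - (a (x 0) (x 1) * a (x 0) (x 2) * a (x 1) (x 2)) := by
      have h10 := ha (x 1) (x 0)
      have h20 := ha (x 2) (x 0)
      have h21 := ha (x 2) (x 1)
      fin_cases i <;> fin_cases j <;>
        first
        | exact absurd rfl hij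
        | (simp [Equiv.swap_apply_def, h10, h20, h21]; try (first | (left; ring1) | ring1))
    rw [key]
    push_cast
    ring

theorem han_ansatz_discontinuity (d : ℕ) (hd : 1 ≤ d)
    (Ψ : (Fin 3 → EuclideanSpace ℝ (Fin d)) → ℝ)
    (hΨcont : Continuous Ψ) (hΨanti : Antisymmetric' Ψ)
    (hTiling : TilingProperty Ψ)
    (x₁ x₂ x₃ x₄ : EuclideanSpace ℝ (Fin d))
    (hΨneg : Ψ ![x₁, x₂, x₃] * Ψ ![x₁, x₂, x₄] * Ψ ![x₁, x₃, x₄] * Ψ ![x₂, x₃, x₄] < 0) :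
    ¬ ∃ (φB : EuclideanSpace ℝ (Fin d) → EuclideanSpace ℝ (Fin d) → ℝ)
        (φC : (Fin 3 → EuclideanSpace ℝ (Fin d)) → ℝ),
      (Continuous fun p : EuclideanSpace ℝ (Fin d) × EuclideanSpace ℝ (Fin d) =>
        φB p.1 p.2) ∧
      ∀ x : Fin 3 → EuclideanSpace ℝ (Fin d),
        φC x * ((φB (x 1) (x 0) - φB (x 0) (x 1)) *
          (φB (x 2) (x 0) - φB (x 0) (x 2)) *
          (φB (x 2) (x 1) - φB (x 1) (x 2))) = Ψ x := by
  rintro ⟨φB, φC, hc, h⟩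
  obtain ⟨a, ha⟩ : ∃ a : EuclideanSpace ℝ (Fin d) → EuclideanSpace ℝ (Fin d) → ℝ,
      a = fun x y => φB y x - φB x y := ⟨_, rfl⟩
  have haa : ∀ x y, a x y = - a y x := by intro x y; simp [ha]
  have hac : Continuous fun p : EuclideanSpace ℝ (Fin d) × EuclideanSpace ℝ (Fin d) =>
      a p.1 p.2 := by
    subst ha
    exact (hc.comp (continuous_snd.prodMk continuous_fst)).sub hc
  obtain ⟨P, hP⟩ : ∃ P : (Fin 3 → EuclideanSpace ℝ (Fin d)) → ℝ,
      P = fun x => a (x 0) (x 1) * a (x 0) (x 2) * a (x 1) (x 2) := ⟨_, rfl⟩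
  have hPc : Continuous P := by
    have hij : ∀ i j : Fin 3, Continuous fun x : Fin 3 → EuclideanSpace ℝ (Fin d) =>
        a (x i) (x j) := fun i j =>
      hac.comp (f := fun x : Fin 3 → EuclideanSpace ℝ (Fin d) => (x i, x j))
        ((continuous_apply i).prodMk (continuous_apply j))
    rw [hP]
    exact ((hij 0 1).mul (hij 0 2)).mul (hij 1 2)
  have hPΨ : ∀ x, Ψ x ≠ 0 → P x ≠ 0 := by
    intro x hx h0
    apply hx
    rw [← h x]
    simp only [hP, ha] at h0
    rw [h0, mul_zero]
  have hsym : ∀ (σ : Equiv.Perm (Fin 3)) x, P (x ∘ σ) * Ψ (x ∘ σ) = P x * Ψ x := by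
    intro σ x
    have h1 : P (x ∘ σ) = ((Equiv.Perm.sign σ : ℤ) : ℝ) * P x := by
      rw [hP]; exact han_aux_perm a haa σ x
    rw [h1, hΨanti σ x]
    rcases Int.units_eq_one_or (Equiv.Perm.sign σ) with e | e <;> rw [e] <;> simp
  -- the sign of `P * Ψ` is constant off the nodes
  have hsign : ∀ x y, Ψ x ≠ 0 → Ψ y ≠ 0 → 0 < P x * Ψ x → 0 < P y * Ψ y := by
    intro x y hx hy hpos
    obtain ⟨σ, hσ⟩ := hTiling x hx y hy
    by_contra hneg
    have hmem : x ∘ σ ∈ {z | Ψ z ≠ 0} := by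
      by_contra hn
      rw [connectedComponentIn_eq_empty hn] at hσ
      exact hσ
    have hpre : IsPreconnected (connectedComponentIn {z | Ψ z ≠ 0} (x ∘ σ)) :=
      isPreconnected_connectedComponentIn
    have hiv := hpre.intermediate_value hσ (mem_connectedComponentIn hmem)
      (hPc.mul hΨcont).continuousOn
    have h0 : (0 : ℝ) ∈ Set.Icc (P y * Ψ y) (P (x ∘ σ) * Ψ (x ∘ σ)) :=
      ⟨not_lt.mp hneg, by rw [hsym]; exact hpos.le⟩
    obtain ⟨z, hz, hz0⟩ := hiv h0
    have hzΨ : Ψ z ≠ 0 := connectedComponentIn_subset _ _ hz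
    exact mul_ne_zero (hPΨ z hzΨ) hzΨ hz0
  have hne := hΨneg.ne
  obtain ⟨⟨⟨n1, n2⟩, n3⟩, n4⟩ : ((Ψ ![x₁, x₂, x₃] ≠ 0 ∧ Ψ ![x₁, x₂, x₄] ≠ 0) ∧
      Ψ ![x₁, x₃, x₄] ≠ 0) ∧ Ψ ![x₂, x₃, x₄] ≠ 0 := by
    simpa only [mul_ne_zero_iff] using hne
  have hall : 0 < (P ![x₁, x₂, x₃] * Ψ ![x₁, x₂, x₃]) * (P ![x₁, x₂, x₄] * Ψ ![x₁, x₂, x₄]) *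
      ((P ![x₁, x₃, x₄] * Ψ ![x₁, x₃, x₄]) * (P ![x₂, x₃, x₄] * Ψ ![x₂, x₃, x₄])) := by
    have two : ∀ x y, Ψ x ≠ 0 → Ψ y ≠ 0 → 0 < (P x * Ψ x) * (P y * Ψ y) := by
      intro x y hx hy
      rcases (mul_ne_zero (hPΨ x hx) hx).lt_or_gt with l | l
      · rcases (mul_ne_zero (hPΨ y hy) hy).lt_or_gt with m | m
        · exact mul_pos_of_neg_of_neg l m
        · exact absurd (hsign y x hy hx m) l.not_gt
      · exact mul_pos l (hsign x y hx hy l)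
    exact mul_pos (two _ _ n1 n2) (two _ _ n3 n4)
  have hPP : 0 ≤ P ![x₁, x₂, x₃] * P ![x₁, x₂, x₄] * P ![x₁, x₃, x₄] * P ![x₂, x₃, x₄] := by
    have : P ![x₁, x₂, x₃] * P ![x₁, x₂, x₄] * P ![x₁, x₃, x₄] * P ![x₂, x₃, x₄]
        = (a x₁ x₂ * a x₁ x₃ * a x₁ x₄ * a x₂ x₃ * a x₂ x₄ * a x₃ x₄) ^ 2 := by
      simp [hP]
      ring
    rw [this]
    positivity
  have := mul_nonpos_of_nonneg_of_nonpos hPP hΨneg.le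
  linarith
end

section
/- (Universality) Let N ≥ 2, d ≥ 1, and let Ψ : ((Fin N) → ℝ^d) → ℝ be any antisymmetric function (Ψ(x ∘ σ) = sign(σ) · Ψ(x) for every permutation σ of Fin N). Then there exists a (not necessarily continuous) permutation-equivariant function Φ : ((Fin N) → ℝ^d) → (Fin N → ℝ) (i.e., Φ(x ∘ σ) = Φ(x) ∘ σ for every permutation σ) such that for every configuration x, ∏_{i<j} (Φ(x)(j) − Φ(x)(i)) = Ψ(x), where the product ranges over all pairs i < j in Fin N. -/
open Finset

/-- Vandermonde product over pairs. -/
noncomputable def vprod {N : ℕ} (u : Fin N → ℝ) : ℝ :=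
  ∏ p ∈ Finset.univ.filter (fun p : Fin N × Fin N => p.1 < p.2), (u p.2 - u p.1)

lemma vprod_eq_det {N : ℕ} (u : Fin N → ℝ) : vprod u = (Matrix.vandermonde u).det := by
  rw [Matrix.det_vandermonde, vprod, Finset.prod_filter, Fintype.prod_prod_type]
  refine Finset.prod_congr rfl fun i _ => ?_
  rw [← Finset.prod_filter]
  refine Finset.prod_congr ?_ fun _ _ => rfl
  ext j; simp

lemma vprod_comp {N : ℕ} (u : Fin N → ℝ) (σ : Equiv.Perm (Fin N)) :
    vprod (u ∘ σ) = ((Equiv.Perm.sign σ : ℤ) : ℝ) * vprod u := by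
  rw [vprod_eq_det, vprod_eq_det, ← Matrix.det_permute]
  rfl

lemma vprod_zero {N : ℕ} (hN : 2 ≤ N) : vprod (0 : Fin N → ℝ) = 0 := by
  refine Finset.prod_eq_zero (i := ((⟨0, by omega⟩, ⟨1, by omega⟩) : Fin N × Fin N)) ?_ ?_ <;> simp

lemma exists_pos {N : ℕ} (hN : 2 ≤ N) (s : ℝ) (hs : 0 < s) : ∃ u : Fin N → ℝ, vprod u = s := by
  set S := Finset.univ.filter (fun p : Fin N × Fin N => p.1 < p.2) with hS
  have hc : S.card ≠ 0 := by
    rw [Finset.card_ne_zero]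
    exact ⟨((⟨0, by omega⟩, ⟨1, by omega⟩) : Fin N × Fin N), by simp [hS]⟩
  set v : Fin N → ℝ := fun i => (i : ℕ) with hv
  have hpos : 0 < vprod v := by
    refine Finset.prod_pos fun p hp => ?_
    have : p.1 < p.2 := by simpa using hp
    have h2 : ((p.1 : ℕ) : ℝ) < ((p.2 : ℕ) : ℝ) := by exact_mod_cast this
    simp only [hv]; linarith
  set c : ℝ := (s / vprod v) ^ ((S.card : ℝ)⁻¹) with hcdef
  have hcp : c ^ S.card = s / vprod v := Real.rpow_inv_natCast_pow (by positivity) hc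
  refine ⟨fun i => c * v i, ?_⟩
  have : vprod (fun i => c * v i) = c ^ S.card * vprod v := by
    simp only [vprod, ← mul_sub]
    rw [Finset.prod_mul_distrib, Finset.prod_const]
  rw [this, hcp]
  field_simp

lemma exists_all {N : ℕ} (hN : 2 ≤ N) (s : ℝ) : ∃ u : Fin N → ℝ, vprod u = s := by
  rcases lt_trichotomy s 0 with h | h | h
  · obtain ⟨u, hu⟩ := exists_pos hN (-s) (by linarith)
    refine ⟨u ∘ Equiv.swap ⟨0, by omega⟩ ⟨1, by omega⟩, ?_⟩
    rw [vprod_comp, Equiv.Perm.sign_swap (by simp), hu]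
    simp
  · exact ⟨0, by rw [vprod_zero hN, h]⟩
  · exact exists_pos hN s h

/-- Orbit relation of relabelling. -/
def orbSetoid (N : ℕ) (E : Type) : Setoid (Fin N → E) where
  r x y := ∃ σ : Equiv.Perm (Fin N), x ∘ σ = y
  iseqv :=
    { refl := fun x => ⟨1, rfl⟩
      symm := by
        rintro x y ⟨σ, rfl⟩
        exact ⟨σ⁻¹, by ext i; simp⟩
      trans := by
        rintro x y z ⟨σ, rfl⟩ ⟨τ, rfl⟩
        exact ⟨σ * τ, rfl⟩ }

theorem universality (N d : ℕ) (hN : 2 ≤ N) (hd : 1 ≤ d)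
    (Ψ : (Fin N → EuclideanSpace ℝ (Fin d)) → ℝ)
    (hΨanti : Antisymmetric' Ψ) :
    ∃ Φ : (Fin N → EuclideanSpace ℝ (Fin d)) → (Fin N → ℝ),
      PermEquivariant Φ ∧
      ∀ x, (∏ p ∈ Finset.univ.filter (fun p : Fin N × Fin N => p.1 < p.2),
        (Φ x p.2 - Φ x p.1)) = Ψ x := by
  classical
  choose u hu using exists_all hN
  let r : (Fin N → EuclideanSpace ℝ (Fin d)) → (Fin N → EuclideanSpace ℝ (Fin d)) :=
    fun x => (Quotient.mk (orbSetoid N _) x).out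
  have hr : ∀ x, ∃ σ : Equiv.Perm (Fin N), r x ∘ σ = x := fun x =>
    Quotient.mk_out (s := orbSetoid N _) x
  have hrσ : ∀ x (σ : Equiv.Perm (Fin N)), r (x ∘ σ) = r x := fun x σ => by
    have : Quotient.mk (orbSetoid N _) (x ∘ σ) = Quotient.mk (orbSetoid N _) x :=
      (Quotient.sound (s := orbSetoid N _) ⟨σ, rfl⟩).symm
    simp only [r, this]
  choose τ hτ using hr
  have hinj : ∀ x, ¬ Function.Injective x → Ψ x = 0 := by
    intro x hx
    simp only [Function.Injective, not_forall] at hx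
    obtain ⟨i, j, hij, hne⟩ := hx
    have h1 := hΨanti (Equiv.swap i j) x
    have h2 : x ∘ Equiv.swap i j = x := by
      ext1 k
      simp only [Function.comp, Equiv.swap_apply_def]
      split_ifs with h h' <;> simp_all
    rw [h2, Equiv.Perm.sign_swap hne] at h1
    push_cast at h1
    linarith
  refine ⟨fun x => if Function.Injective x then u (Ψ (r x)) ∘ τ x else 0, ?_, ?_⟩
  · intro σ x
    by_cases hx : Function.Injective x
    · have hx' : Function.Injective (x ∘ σ) := hx.comp σ.injective
      have hri : Function.Injective (r x) := by
        apply (Equiv.injective_comp (τ x) (r x)).1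
        rw [hτ x]
        exact hx
      have h1 : ∀ i, τ (x ∘ σ) i = τ x (σ i) := fun i => by
        apply hri
        have a := congrFun (hτ (x ∘ σ)) i
        have b := congrFun (hτ x) (σ i)
        rw [hrσ] at a
        exact a.trans b.symm
      simp only [hx, hx', if_true, hrσ]
      ext i
      simp [h1]
    · have hx' : ¬ Function.Injective (x ∘ σ) := by
        intro h; exact hx ((Equiv.injective_comp σ x).1 h)
      simp only [hx, hx', if_false]
      rfl
  · intro x
    change vprod (if Function.Injective x then u (Ψ (r x)) ∘ τ x else 0) = Ψ x
    split_ifs with hx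
    · rw [vprod_comp, hu, ← hΨanti, hτ]
    · rw [vprod_zero hN, hinj x hx]
end

section
/- Let N ≥ 2, d ≥ 1, and let Ψ : ((Fin N) → ℝ^d) → ℝ be any antisymmetric function (Ψ(x ∘ σ) = sign(σ) · Ψ(x) for every permutation σ of Fin N). Then there exist (not necessarily continuous) permutation-equivariant functions Φ_A, Φ_B : ((Fin N) → ℝ^d) → (Fin N → ℝ) (i.e., Φ(x ∘ σ) = Φ(x) ∘ σ for every permutation σ) such that for every configuration x, ∏_{i<j} (Φ_A(x)(i)·Φ_B(x)(j) − Φ_A(x)(j)·Φ_B(x)(i)) = Ψ(x), where the product ranges over all pairs i < j in Fin N. -/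
open Finset

/-- The Vandermonde product over pairs. -/
def pairProd {N : ℕ} (v : Fin N → ℝ) : ℝ :=
  ∏ p ∈ Finset.univ.filter (fun p : Fin N × Fin N => p.1 < p.2), (v p.2 - v p.1)

theorem pairProd_eq_det {N : ℕ} (v : Fin N → ℝ) :
    pairProd v = (Matrix.vandermonde v).det := by
  rw [Matrix.det_vandermonde, pairProd, Finset.prod_filter, Fintype.prod_prod_type]
  refine Finset.prod_congr rfl fun i _ => ?_
  rw [← Finset.prod_filter]
  refine Finset.prod_congr ?_ fun _ _ => rfl
  ext j
  simp

theorem pairProd_comp {N : ℕ} (v : Fin N → ℝ) (σ : Equiv.Perm (Fin N)) :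
    pairProd (v ∘ σ) = ((Equiv.Perm.sign σ : ℤ) : ℝ) * pairProd v := by
  rw [pairProd_eq_det, pairProd_eq_det, ← Matrix.det_permute]
  rfl

theorem exists_perm_of_range {N : ℕ} {E : Type*} (r y : Fin N → E)
    (hy : Function.Injective y) (h : Set.range y = Set.range r) :
    ∃ σ : Equiv.Perm (Fin N), y = r ∘ σ := by
  have h1 : ∀ i, ∃ j, r j = y i := fun i => by
    have : y i ∈ Set.range r := h ▸ Set.mem_range_self i
    exact this
  choose s hs using h1
  have hinj : Function.Injective s := fun i j hij => hy (by rw [← hs i, ← hs j, hij])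
  refine ⟨Equiv.ofBijective s (Finite.injective_iff_bijective.mp hinj), ?_⟩
  funext i
  exact (hs i).symm

theorem exists_label {N d : ℕ} (hN : 2 ≤ N)
    (Ψ : (Fin N → EuclideanSpace ℝ (Fin d)) → ℝ)
    (hΨ : Antisymmetric' Ψ) (S : Set (EuclideanSpace ℝ (Fin d))) :
    ∃ F : EuclideanSpace ℝ (Fin d) → ℝ, ∀ y : Fin N → EuclideanSpace ℝ (Fin d),
      Function.Injective y → Set.range y = S → pairProd (F ∘ y) = Ψ y := by
  by_cases hS : ∃ y : Fin N → EuclideanSpace ℝ (Fin d), Function.Injective y ∧ Set.range y = S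
  swap
  · exact ⟨0, fun y h1 h2 => (hS ⟨y, h1, h2⟩).elim⟩
  have i0 : Fin N := ⟨0, by omega⟩
  have : Nonempty (Fin N) := ⟨i0⟩
  have hr : ∃ r : Fin N → EuclideanSpace ℝ (Fin d),
      Function.Injective r ∧ Set.range r = S ∧ 0 ≤ Ψ r := by
    obtain ⟨y, h1, h2⟩ := hS
    by_cases h : 0 ≤ Ψ y
    · exact ⟨y, h1, h2, h⟩
    · have hne : (⟨0, by omega⟩ : Fin N) ≠ ⟨1, by omega⟩ := by simp
      refine ⟨y ∘ Equiv.swap (⟨0, by omega⟩ : Fin N) ⟨1, by omega⟩,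
        h1.comp (Equiv.injective _), ?_, ?_⟩
      · rw [EquivLike.range_comp, h2]
      · rw [hΨ, Equiv.Perm.sign_swap hne]
        push_cast
        linarith
  obtain ⟨r, hri, hrS, hr0⟩ := hr
  set P := Finset.univ.filter (fun p : Fin N × Fin N => p.1 < p.2) with hP
  have hm : P.card ≠ 0 := by
    rw [Finset.card_ne_zero]
    exact ⟨(⟨0, by omega⟩, ⟨1, by omega⟩), by simp [hP]⟩
  set V := pairProd (fun i : Fin N => (i : ℝ)) with hV
  have hVpos : 0 < V := by
    refine Finset.prod_pos fun p hp => ?_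
    have hlt : p.1 < p.2 := by simpa using hp
    have : ((p.1 : ℕ) : ℝ) < ((p.2 : ℕ) : ℝ) := by exact_mod_cast hlt
    linarith
  set t : ℝ := (Ψ r / V) ^ ((P.card : ℝ)⁻¹) with ht
  have htp : t ^ P.card = Ψ r / V := Real.rpow_inv_natCast_pow (by positivity) hm
  let F : EuclideanSpace ℝ (Fin d) → ℝ := fun e => t * ((Function.invFun r e : Fin N) : ℝ)
  have hFr : pairProd (F ∘ r) = Ψ r := by
    have h1 : F ∘ r = fun i : Fin N => t * (i : ℝ) := by
      funext i
      simp [F, Function.leftInverse_invFun hri i]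
    have h2 : pairProd (fun i : Fin N => t * (i : ℝ)) = t ^ P.card * V := by
      rw [hV, pairProd, pairProd, ← Finset.prod_const, ← Finset.prod_mul_distrib]
      exact Finset.prod_congr rfl fun p _ => by ring
    rw [h1, h2, htp]
    field_simp
  refine ⟨F, fun y hy hyS => ?_⟩
  obtain ⟨σ, rfl⟩ := exists_perm_of_range r y hy (hyS.trans hrS.symm)
  rw [hΨ, ← Function.comp_assoc, pairProd_comp, hFr]

theorem universality_extended (N d : ℕ) (hN : 2 ≤ N) (hd : 1 ≤ d)
    (Ψ : (Fin N → EuclideanSpace ℝ (Fin d)) → ℝ)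
    (hΨanti : Antisymmetric' Ψ) :
    ∃ ΦA ΦB : (Fin N → EuclideanSpace ℝ (Fin d)) → (Fin N → ℝ),
      PermEquivariant ΦA ∧ PermEquivariant ΦB ∧
      ∀ x, (∏ p ∈ Finset.univ.filter (fun p : Fin N × Fin N => p.1 < p.2),
        (ΦA x p.1 * ΦB x p.2 - ΦA x p.2 * ΦB x p.1)) = Ψ x := by
  choose F hF using exists_label hN Ψ hΨanti
  refine ⟨fun _ _ => 1, fun x i => F (Set.range x) (x i), fun _ _ => rfl, ?_, fun x => ?_⟩
  · intro σ x
    funext i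
    simp only [EquivLike.range_comp, Function.comp_apply]
  · simp only [one_mul]
    change pairProd (F (Set.range x) ∘ x) = Ψ x
    by_cases hx : Function.Injective x
    · exact hF _ x hx rfl
    · obtain ⟨i, j, hij, hne⟩ : ∃ i j, x i = x j ∧ i ≠ j := by
        simpa [Function.Injective] using hx
      have hswap : x ∘ Equiv.swap i j = x := by
        funext k
        rcases eq_or_ne k i with rfl | hki
        · simp [hij]
        rcases eq_or_ne k j with rfl | hkj
        · simp [hij]
        simp [Equiv.swap_apply_of_ne_of_ne hki hkj]
      have h1 := hΨanti (Equiv.swap i j) x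
      have h2 := pairProd_comp (F (Set.range x) ∘ x) (Equiv.swap i j)
      rw [Function.comp_assoc] at h2
      rw [hswap, Equiv.Perm.sign_swap hne] at h1 h2
      push_cast at h1 h2
      linarith
end
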